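/- Let q = 2^n, let B be a k-subset of GF(q), and let E be a subset of GF(q) such that f̂_B(μ) = f̂_E(μ^d) for all μ ∈ GF(q), where d is a positive integer with gcd(d, q−1) = 1. Let u₁, u₂, u₃ be three pairwise distinct elements of GF(q). Then I_B(u₁, u₂, u₃) = N_E((u₂+u₃)^d, (u₃+u₁)^d, (u₁+u₂)^d). -/

import Mathlib

open Finset

noncomputable instance (n : ℕ) : Fintype (GaloisField 2 n) := Fintype.ofFinite _

/-- The absolute trace map from `GF(2^n)` to `GF(2)`. -/
noncomputable def Tr (n : ℕ) (x : GaloisField 2 n) : ZMod 2 :=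
  Algebra.trace (ZMod 2) (GaloisField 2 n) x

/-- The characteristic function of a subset `B ⊆ GF(2^n)`. -/
noncomputable def charFun {n : ℕ} (B : Set (GaloisField 2 n)) (x : GaloisField 2 n) : ZMod 2 :=
  open scoped Classical in if x ∈ B then 1 else 0

/-- The Walsh transform of a Boolean function on `GF(2^n)`, as an integer. -/
noncomputable def walsh {n : ℕ} (f : GaloisField 2 n → ZMod 2) (μ : GaloisField 2 n) : ℤ :=
  ∑ x : GaloisField 2 n, (-1 : ℤ) ^ (f x + Tr n (μ * x)).val

/-- The orbit of a base block `B ⊆ GF(2^n)` under the general affine group `GA₁(2^n)`,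
i.e. the set of all blocks `aB + b` with `a ≠ 0`. -/
def affOrbit {n : ℕ} (B : Set (GaloisField 2 n)) : Set (Set (GaloisField 2 n)) :=
  {S | ∃ a b : GaloisField 2 n, a ≠ 0 ∧ S = (fun x => a * x + b) '' B}

/-- `N_E(a,b,c)`: the number of triples `(x,y,z) ∈ E³` with `ax + by + cz = 0`. -/
noncomputable def NE {n : ℕ} (E : Set (GaloisField 2 n)) (a b c : GaloisField 2 n) : ℕ :=
  Nat.card {t : GaloisField 2 n × GaloisField 2 n × GaloisField 2 n //
    t.1 ∈ E ∧ t.2.1 ∈ E ∧ t.2.2 ∈ E ∧ a * t.1 + b * t.2.1 + c * t.2.2 = 0}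

/-- `I_B(u₁,u₂,u₃)`: the number of pairs `(x,y) ∈ GF(2^n)²` with `uᵢ x + y ∈ B` for `i = 1,2,3`. -/
noncomputable def IB {n : ℕ} (B : Set (GaloisField 2 n)) (u₁ u₂ u₃ : GaloisField 2 n) : ℕ :=
  Nat.card {p : GaloisField 2 n × GaloisField 2 n //
    u₁ * p.1 + p.2 ∈ B ∧ u₂ * p.1 + p.2 ∈ B ∧ u₃ * p.1 + p.2 ∈ B}

/-- The incidence structure `(GF(2^n), affOrbit B)` is a 3-design: there is a `λ` such that
every 3-subset of points lies in exactly `λ` blocks of the orbit. -/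
def Is3Design {n : ℕ} (B : Set (GaloisField 2 n)) : Prop :=
  ∃ lam : ℕ, ∀ u v w : GaloisField 2 n, u ≠ v → u ≠ w → v ≠ w →
    Nat.card {S : Set (GaloisField 2 n) // S ∈ affOrbit B ∧ u ∈ S ∧ v ∈ S ∧ w ∈ S} = lam

/-- The canonical additive character `x ↦ (-1)^Tr(x)` of `GF(2^n)`. -/
noncomputable def traceChar (n : ℕ) : AddChar (GaloisField 2 n) ℤ where
  toFun x := (-1) ^ (Tr n x).val
  map_zero_eq_one' := by simp [Tr]
  map_add_eq_mul' x y := by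
    have h : ∀ a b : ZMod 2, (-1 : ℤ) ^ (a + b).val = (-1) ^ a.val * (-1) ^ b.val := by decide
    simp only [Tr, map_add, h]

lemma traceChar_apply {n : ℕ} (x : GaloisField 2 n) : traceChar n x = (-1) ^ (Tr n x).val := rfl

lemma traceChar_isPrimitive (n : ℕ) : (traceChar n).IsPrimitive := by
  refine AddChar.IsPrimitive.of_ne_one (AddChar.ne_one_iff.2 ?_)
  obtain ⟨x, hx⟩ := Algebra.trace_surjective (ZMod 2) (GaloisField 2 n) 1
  refine ⟨x, ?_⟩
  rw [traceChar_apply, Tr, hx]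
  decide

/-- The Fourier transform of the integer-valued indicator function of `B`. -/
noncomputable def charSum {n : ℕ} (B : Set (GaloisField 2 n)) (μ : GaloisField 2 n) : ℤ :=
  ∑ x, B.indicator 1 x * traceChar n (x * μ)

lemma walsh_charFun {n : ℕ} (B : Set (GaloisField 2 n)) (μ : GaloisField 2 n) :
    walsh (charFun B) μ = ∑ x, traceChar n (x * μ) - 2 * charSum B μ := by
  have h : ∀ a : ZMod 2, (-1 : ℤ) ^ (1 + a).val = -(-1) ^ a.val := by decide
  rw [walsh, charSum, mul_sum, ← sum_sub_distrib]
  refine sum_congr rfl fun x _ => ?_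
  rw [traceChar_apply, mul_comm x μ]
  by_cases hx : x ∈ B
  · simp only [charFun, hx, if_true, Set.indicator_of_mem, Pi.one_apply, h]
    ring
  · simp [charFun, hx]

lemma charSum_eq_of_walsh_eq {n : ℕ} {B E : Set (GaloisField 2 n)} {μ ν : GaloisField 2 n}
    (hμν : μ = 0 ↔ ν = 0) (h : walsh (charFun B) μ = walsh (charFun E) ν) :
    charSum B μ = charSum E ν := by
  classical
  simp only [walsh_charFun, AddChar.sum_mulShift _ (traceChar_isPrimitive n), hμν] at h
  linarith

lemma pow_bijective_of_gcd_eq_one {n d : ℕ} (hn : 0 < n) (hd : 0 < d)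
    (hgcd : Nat.gcd d (2 ^ n - 1) = 1) :
    Function.Bijective fun x : GaloisField 2 n => x ^ d := by
  refine Finite.injective_iff_bijective.1 fun x y hxy => ?_
  have hxy : x ^ d = y ^ d := hxy
  by_cases hx : x = 0
  · subst hx
    rw [zero_pow hd.ne'] at hxy
    exact (eq_zero_of_pow_eq_zero hxy.symm).symm
  by_cases hy : y = 0
  · subst hy
    rw [zero_pow hd.ne'] at hxy
    exact eq_zero_of_pow_eq_zero hxy
  have hcop : (Nat.card (GaloisField 2 n)ˣ).Coprime d := by
    rw [Nat.card_units, GaloisField.card 2 n hn.ne']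
    exact Nat.Coprime.symm hgcd
  have h : Units.mk0 x hx = Units.mk0 y hy := (powCoprime hcop).injective <| by
    simpa [Units.ext_iff] using hxy
  simpa [Units.ext_iff] using h

lemma card_mul_NE {n : ℕ} (E : Set (GaloisField 2 n)) (a b c : GaloisField 2 n) :
    (Fintype.card (GaloisField 2 n) : ℤ) * NE E a b c =
      ∑ μ, charSum E (a * μ) * charSum E (b * μ) * charSum E (c * μ) := by
  classical
  have key (μ : GaloisField 2 n) : charSum E (a * μ) * charSum E (b * μ) * charSum E (c * μ) =
      ∑ t : GaloisField 2 n × GaloisField 2 n × GaloisField 2 n,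
        E.indicator 1 t.1 * E.indicator 1 t.2.1 * E.indicator 1 t.2.2 *
          traceChar n (μ * (a * t.1 + b * t.2.1 + c * t.2.2)) := by
    rw [charSum, charSum, charSum, sum_mul_sum]
    simp only [Fintype.sum_prod_type, sum_mul]
    simp only [mul_sum]
    refine sum_congr rfl fun x _ => sum_congr rfl fun y _ => sum_congr rfl fun z _ => ?_
    rw [show μ * (a * x + b * y + c * z) = x * (a * μ) + y * (b * μ) + z * (c * μ) by ring]
    simp only [AddChar.map_add_eq_mul]
    ring
  simp only [key]
  rw [sum_comm]
  simp only [← mul_sum, AddChar.sum_mulShift _ (traceChar_isPrimitive n)]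
  rw [NE, Nat.card_eq_fintype_card, Fintype.card_subtype, card_filter]
  push_cast
  rw [mul_sum]
  refine sum_congr rfl fun t _ => ?_
  simp only [Set.indicator_apply, Pi.one_apply]
  split_ifs <;> simp_all

lemma IB_eq_NE {n : ℕ} (B : Set (GaloisField 2 n)) {u₁ u₂ : GaloisField 2 n}
    (u₃ : GaloisField 2 n) (h12 : u₁ ≠ u₂) :
    IB B u₁ u₂ u₃ = NE B (u₂ + u₃) (u₃ + u₁) (u₁ + u₂) := by
  have h2 : (2 : GaloisField 2 n) = 0 := CharTwo.two_eq_zero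
  have h0 : u₁ + u₂ ≠ 0 := fun h => h12 (CharTwo.add_eq_zero.1 h)
  refine Nat.card_eq_of_bijective (fun p => ⟨(u₁ * p.1.1 + p.1.2, u₂ * p.1.1 + p.1.2,
    u₃ * p.1.1 + p.1.2), p.2.1, p.2.2.1, p.2.2.2, ?_⟩) ⟨?_, ?_⟩
  · linear_combination (u₁ * u₂ * p.1.1 + u₁ * u₃ * p.1.1 + u₂ * u₃ * p.1.1 +
      (u₁ + u₂ + u₃) * p.1.2) * h2
  · rintro ⟨⟨x, y⟩, _⟩ ⟨⟨x', y'⟩, _⟩ h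
    simp only [Subtype.mk.injEq, Prod.mk.injEq] at h ⊢
    obtain ⟨e1, e2, -⟩ := h
    have hx : x = x' := mul_left_cancel₀ h0 <| by
      linear_combination e1 + e2 + (y' - y) * h2
    subst hx
    exact ⟨rfl, add_left_cancel e1⟩
  · rintro ⟨⟨x, y, z⟩, hx, hy, hz, h⟩
    dsimp only at hx hy hz h
    obtain ⟨w, hw⟩ : ∃ w, (u₁ + u₂) * w = x + y := ⟨(x + y) / (u₁ + u₂), by field_simp⟩
    have e1 : u₁ * w + (x + u₁ * w) = x := by linear_combination u₁ * w * h2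
    have e2 : u₂ * w + (x + u₁ * w) = y := by linear_combination hw + x * h2
    have e3 : u₃ * w + (x + u₁ * w) = z := mul_left_cancel₀ h0 <| by
      linear_combination (u₃ + u₁) * hw - h + (u₁ * x + u₂ * x + u₃ * x + u₃ * y + u₁ * y) * h2
    exact ⟨⟨(w, x + u₁ * w), by rwa [e1], by rwa [e2], by rwa [e3]⟩,
      Subtype.ext (Prod.ext e1 (Prod.ext e2 e3))⟩

/-- Lemma 2.5: `I_B(u₁,u₂,u₃) = N_E((u₂+u₃)^d, (u₃+u₁)^d, (u₁+u₂)^d)`. -/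
theorem stmt_5 (n k d : ℕ) (hn : 0 < n) (hd : 0 < d) (hgcd : Nat.gcd d (2 ^ n - 1) = 1)
    (B E : Set (GaloisField 2 n)) (hB : B.ncard = k)
    (hBE : ∀ μ : GaloisField 2 n, walsh (charFun B) μ = walsh (charFun E) (μ ^ d))
    (u₁ u₂ u₃ : GaloisField 2 n) (h12 : u₁ ≠ u₂) (h13 : u₁ ≠ u₃) (h23 : u₂ ≠ u₃) :
    IB B u₁ u₂ u₃ = NE E ((u₂ + u₃) ^ d) ((u₃ + u₁) ^ d) ((u₁ + u₂) ^ d) := by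
  have hbij := pow_bijective_of_gcd_eq_one hn hd hgcd
  have hsum (μ : GaloisField 2 n) : charSum B μ = charSum E (μ ^ d) :=
    charSum_eq_of_walsh_eq (pow_eq_zero_iff hd.ne').symm (hBE μ)
  have hcard : (Fintype.card (GaloisField 2 n) : ℤ) ≠ 0 := by
    exact_mod_cast Fintype.card_ne_zero
  rw [IB_eq_NE B u₃ h12]
  refine Int.ofNat_inj.1 (mul_left_cancel₀ hcard ?_)
  rw [card_mul_NE, card_mul_NE]
  refine Fintype.sum_bijective _ hbij _ _ fun μ => ?_
  simp only [hsum, mul_pow]
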